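/- Let B be a stationary Bratteli diagram with N × N incidence matrix F whose tail equivalence relation R is aperiodic, and suppose F is in Frobenius normal form (block lower triangular) with every nonzero diagonal block primitive. Let A = F^T, core(A) = ⋂_{k ≥ 1} A^k(ℝ_+^N), and D = {x ∈ core(A) : Σ_{w ∈ V_1} h_w^{(1)} x_w = 1}. Then the map μ ↦ p^{(1)} = (μ(X_w^{(1)})/h_w^{(1)})_{w ∈ V_1} is a one-to-one correspondence between R-invariant Borel probability measures on X_B and vectors of D; moreover, the ergodic measures correspond exactly to the extreme vectors ξ_1,…,ξ_k of the cone core(A), normalized to lie in D. In particular, there exist exactly k ergodic R-invariant probability measures on X_B. -/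

import Mathlib

open MeasureTheory

/-- A Bratteli diagram. -/
structure BratteliDiagram where
  V : ℕ → Type
  E : ℕ → Type
  fintypeV : ∀ n, Fintype (V n)
  fintypeE : ∀ n, Fintype (E n)
  nonemptyV : ∀ n, Nonempty (V n)
  nonemptyE : ∀ n, Nonempty (E n)
  root_subsingleton : ∀ v w : V 0, v = w
  src : ∀ n, E n → V n
  rng : ∀ n, E n → V (n + 1)
  src_surj : ∀ n, Function.Surjective (src n)
  rng_surj : ∀ n, Function.Surjective (rng n)

attribute [instance] BratteliDiagram.fintypeV BratteliDiagram.fintypeE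
  BratteliDiagram.nonemptyV BratteliDiagram.nonemptyE

namespace BratteliDiagram

variable (B : BratteliDiagram)

instance (n : ℕ) : TopologicalSpace (B.E n) := ⊥

/-- The path space `X_B` of a Bratteli diagram. -/
def PathSpace : Type :=
  { x : ∀ n, B.E n // ∀ n, B.rng n (x n) = B.src (n + 1) (x (n + 1)) }

instance : TopologicalSpace B.PathSpace := by unfold PathSpace; infer_instance

noncomputable instance : MeasurableSpace B.PathSpace := borel _

/-- The vertex at level `n` through which a path passes. -/
def endVtx (n : ℕ) (x : B.PathSpace) : B.V n := B.src n (x.1 n)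

/-- The cylinder set of paths agreeing with `x` on the first `n` edges. -/
def cyl (n : ℕ) (x : B.PathSpace) : Set B.PathSpace := { y | ∀ i < n, y.1 i = x.1 i }

/-- Tail equivalence of paths. -/
def tailEq (x y : B.PathSpace) : Prop := ∃ N, ∀ n, N ≤ n → x.1 n = y.1 n

/-- The tail equivalence relation is aperiodic: all classes are infinite. -/
def TailAperiodic : Prop := ∀ x : B.PathSpace, { y | B.tailEq x y }.Infinite

/-- A measure is invariant for the tail equivalence relation if any two
cylinder sets ending at the same vertex have equal measure. -/
def TailInvariant (μ : Measure B.PathSpace) : Prop :=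
  ∀ (n : ℕ) (x y : B.PathSpace), B.endVtx n x = B.endVtx n y →
    μ (B.cyl n x) = μ (B.cyl n y)

/-- Ergodicity with respect to the tail equivalence relation. -/
def TailErgodic (μ : Measure B.PathSpace) : Prop :=
  ∀ S : Set B.PathSpace, MeasurableSet S →
    (∀ x y, B.tailEq x y → (x ∈ S ↔ y ∈ S)) → μ S = 0 ∨ μ Sᶜ = 0

/-- The type of finite paths from the root vertex to `v`. -/
def FinPathTo : ∀ n, B.V n → Type
  | 0, _ => PUnit
  | n + 1, v => Σ e : { e : B.E n // B.rng n e = v }, FinPathTo n (B.src n e.1)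

/-- The height `h_v^{(n)}`: the number of finite paths from the root to `v`. -/
noncomputable def height (n : ℕ) (v : B.V n) : ℕ := Nat.card (B.FinPathTo n v)

/-- The number of edges from `w ∈ V_n` to `v ∈ V_{n+1}`; the entry `f^{(n)}_{v,w}`
of the incidence matrix `F_n`. -/
noncomputable def edgeCount (n : ℕ) (v : B.V (n + 1)) (w : B.V n) : ℕ :=
  Nat.card { e : B.E n // B.rng n e = v ∧ B.src n e = w }

/-- The incidence matrix `F_n`, as a real matrix. -/
noncomputable def incMat (n : ℕ) : Matrix (B.V (n + 1)) (B.V n) ℝ :=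
  fun v w => (B.edgeCount n v w : ℝ)

end BratteliDiagram

/-- The diagonal block of `F` on the class `α` of the class map `c`. -/
def blockOf {N m : ℕ} (F : Matrix (Fin N) (Fin N) ℝ) (c : Fin N → Fin m) (α : Fin m) :
    Matrix { i : Fin N // c i = α } { i : Fin N // c i = α } ℝ :=
  fun i j => F i.1 j.1

/-- A nonnegative square matrix is primitive if some positive power is strictly positive. -/
def IsPrimitiveMat {ι : Type} [Fintype ι] [DecidableEq ι] (M : Matrix ι ι ℝ) : Prop :=
  (∀ i j, 0 ≤ M i j) ∧ ∃ p : ℕ, 0 < p ∧ ∀ i j, 0 < (M ^ p) i j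

/-- `core(A) = ⋂_{k ≥ 1} A^k (ℝ_+^N)`. -/
def coreCone {N : ℕ} (A : Matrix (Fin N) (Fin N) ℝ) : Set (Fin N → ℝ) :=
  ⋂ k : ℕ, { y | ∃ x : Fin N → ℝ, (∀ i, 0 ≤ x i) ∧ (A ^ (k + 1)).mulVec x = y }

/-- `x` generates an extreme ray of the cone `C`. -/
def IsExtremeRayVec {N : ℕ} (C : Set (Fin N → ℝ)) (x : Fin N → ℝ) : Prop :=
  x ∈ C ∧ x ≠ 0 ∧ ∀ y ∈ C, ∀ z ∈ C, x = y + z → ∃ a : ℝ, 0 ≤ a ∧ y = a • x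

section CoreCone

open Filter Topology

variable {N : ℕ} {A : Matrix (Fin N) (Fin N) ℝ}

theorem Matrix.mulVec_nonneg_of_nonneg (hA : ∀ i j, 0 ≤ A i j) {x : Fin N → ℝ}
    (hx : ∀ i, 0 ≤ x i) (i : Fin N) : 0 ≤ A.mulVec x i := by
  simp only [Matrix.mulVec, dotProduct]
  exact Finset.sum_nonneg fun j _ => mul_nonneg (hA i j) (hx j)

theorem Matrix.pow_entries_nonneg (hA : ∀ i j, 0 ≤ A i j) (k : ℕ) :
    ∀ i j, 0 ≤ (A ^ k) i j := by
  induction k with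
  | zero => intro i j; rw [pow_zero, Matrix.one_apply]; split_ifs <;> norm_num
  | succ k ih =>
    intro i j
    rw [pow_succ, Matrix.mul_apply]
    exact Finset.sum_nonneg fun l _ => mul_nonneg (ih i l) (hA l j)

theorem Matrix.sum_le_sum_mulVec (hcol : ∀ j, 1 ≤ ∑ i, A i j)
    {x : Fin N → ℝ} (hx : ∀ i, 0 ≤ x i) : ∑ i, x i ≤ ∑ i, A.mulVec x i := by
  simp only [Matrix.mulVec, dotProduct]
  rw [Finset.sum_comm]
  refine Finset.sum_le_sum fun j _ => ?_
  rw [← Finset.sum_mul]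
  exact le_mul_of_one_le_left (hx j) (hcol j)

theorem Matrix.sum_le_sum_pow_mulVec (hA : ∀ i j, 0 ≤ A i j) (hcol : ∀ j, 1 ≤ ∑ i, A i j)
    (k : ℕ) {x : Fin N → ℝ} (hx : ∀ i, 0 ≤ x i) : ∑ i, x i ≤ ∑ i, (A ^ k).mulVec x i := by
  induction k with
  | zero => simp
  | succ k ih =>
    rw [pow_succ', ← Matrix.mulVec_mulVec]
    exact ih.trans (Matrix.sum_le_sum_mulVec hcol
      (Matrix.mulVec_nonneg_of_nonneg (Matrix.pow_entries_nonneg hA k) hx))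

/-- A sequence of nonnegative vectors of bounded mass has a nonnegative limit along every
ultrafilter. -/
theorem exists_ultrafilter_limit (U : Ultrafilter ℕ) {y : ℕ → Fin N → ℝ} {M : ℝ}
    (h0 : ∀ k i, 0 ≤ y k i) (hM : ∀ᶠ k in (U : Filter ℕ), ∑ i, y k i ≤ M) :
    ∃ z : Fin N → ℝ, (∀ i, 0 ≤ z i) ∧ Tendsto y U (𝓝 z) := by
  have hc : IsCompact (Set.Icc (0 : Fin N → ℝ) (fun _ => M)) := isCompact_Icc
  have hmem : Set.Icc (0 : Fin N → ℝ) (fun _ => M) ∈ U.map y := by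
    refine Ultrafilter.mem_map.2 (hM.mono fun k hk => ?_)
    exact ⟨h0 k, fun i => (Finset.single_le_sum (fun j _ => h0 k j) (Finset.mem_univ i)).trans hk⟩
  obtain ⟨z, hz, hlim⟩ := hc.ultrafilter_le_nhds' _ hmem
  exact ⟨z, hz.1, hlim⟩

theorem tendsto_mulVec (M : Matrix (Fin N) (Fin N) ℝ) {l : Filter ℕ} {y : ℕ → Fin N → ℝ}
    {z : Fin N → ℝ} (h : Tendsto y l (𝓝 z)) :
    Tendsto (fun k => M.mulVec (y k)) l (𝓝 (M.mulVec z)) :=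
  ((continuous_const.matrix_mulVec continuous_id).tendsto z).comp h

theorem mem_coreCone {x : Fin N → ℝ} : x ∈ coreCone A ↔
    ∀ k : ℕ, ∃ y : Fin N → ℝ, (∀ i, 0 ≤ y i) ∧ (A ^ (k + 1)).mulVec y = x := by
  simp [coreCone]

theorem coreCone_add {x y : Fin N → ℝ} (hx : x ∈ coreCone A) (hy : y ∈ coreCone A) :
    x + y ∈ coreCone A := by
  refine mem_coreCone.2 fun k => ?_
  obtain ⟨a, ha, rfl⟩ := mem_coreCone.1 hx k
  obtain ⟨b, hb, rfl⟩ := mem_coreCone.1 hy k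
  exact ⟨a + b, fun i => add_nonneg (ha i) (hb i), Matrix.mulVec_add _ _ _⟩

theorem coreCone_smul {x : Fin N → ℝ} (hx : x ∈ coreCone A) {a : ℝ} (ha : 0 ≤ a) :
    a • x ∈ coreCone A := by
  refine mem_coreCone.2 fun k => ?_
  obtain ⟨b, hb, rfl⟩ := mem_coreCone.1 hx k
  exact ⟨a • b, fun i => mul_nonneg ha (hb i), Matrix.mulVec_smul _ _ _⟩

theorem coreCone_zero : (0 : Fin N → ℝ) ∈ coreCone A :=
  mem_coreCone.2 fun _ => ⟨0, fun _ => le_rfl, Matrix.mulVec_zero _⟩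

theorem coreCone_sum {ι : Type*} (s : Finset ι) {u : ι → Fin N → ℝ}
    (hu : ∀ i ∈ s, u i ∈ coreCone A) : ∑ i ∈ s, u i ∈ coreCone A :=
  Finset.sum_induction u (· ∈ coreCone A) (fun _ _ => coreCone_add) coreCone_zero hu

/-- A nonnegative backward orbit of `A`. -/
def IsBackwardOrbit (A : Matrix (Fin N) (Fin N) ℝ) (y : ℕ → Fin N → ℝ) : Prop :=
  (∀ n i, 0 ≤ y n i) ∧ ∀ n, A.mulVec (y (n + 1)) = y n

theorem IsBackwardOrbit.mem_coreCone {y : ℕ → Fin N → ℝ} (h : IsBackwardOrbit A y) (n : ℕ) :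
    y n ∈ coreCone A := by
  have key : ∀ k n, (A ^ k).mulVec (y (n + k)) = y n := by
    intro k
    induction k with
    | zero => intro n; simp
    | succ k ih =>
      intro n
      rw [pow_succ, ← Matrix.mulVec_mulVec, ← add_assoc, h.2, ih]
  exact _root_.mem_coreCone.2 fun k => ⟨_, h.1 _, key (k + 1) n⟩

theorem exists_backwardOrbit (hA : ∀ i j, 0 ≤ A i j) (hcol : ∀ j, 1 ≤ ∑ i, A i j)
    {x : Fin N → ℝ} (hx : x ∈ coreCone A) : ∃ y, IsBackwardOrbit A y ∧ y 0 = x := by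
  choose b hb hbx using mem_coreCone.1 hx
  let U : Ultrafilter ℕ := hyperfilter ℕ
  have hU : (U : Filter ℕ) ≤ atTop := Nat.hyperfilter_le_atTop
  have hlim : ∀ n, ∃ z : Fin N → ℝ, (∀ i, 0 ≤ z i) ∧
      Tendsto (fun k => (A ^ (k + 1 - n)).mulVec (b k)) U (𝓝 z) := by
    intro n
    refine exists_ultrafilter_limit U (M := ∑ i, x i)
      (fun k => Matrix.mulVec_nonneg_of_nonneg (Matrix.pow_entries_nonneg hA _) (hb k))
      (hU ((eventually_ge_atTop n).mono fun k hk => ?_))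
    have h := Matrix.sum_le_sum_pow_mulVec hA hcol n
      (Matrix.mulVec_nonneg_of_nonneg (Matrix.pow_entries_nonneg hA (k + 1 - n)) (hb k))
    rwa [Matrix.mulVec_mulVec, ← pow_add, Nat.add_sub_cancel' (by omega), hbx] at h
  choose y hy0 hy using hlim
  refine ⟨y, ⟨hy0, fun n => ?_⟩, ?_⟩
  · refine tendsto_nhds_unique_of_eventuallyEq (tendsto_mulVec A (hy (n + 1))) (hy n)
      (hU ((eventually_ge_atTop n).mono fun k hk => ?_))
    simp only [Matrix.mulVec_mulVec, ← pow_succ']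
    congr 2
    omega
  · refine tendsto_nhds_unique (hy 0) ?_
    simp only [Nat.sub_zero, hbx]
    exact tendsto_const_nhds

theorem coreCone_mulVec_injOn (hA : ∀ i j, 0 ≤ A i j) (hcol : ∀ j, 1 ≤ ∑ i, A i j) :
    Set.InjOn A.mulVec (coreCone A) := by
  have hmap : ∀ x ∈ Submodule.span ℝ (coreCone A),
      A.mulVecLin x ∈ Submodule.span ℝ (coreCone A) := by
    intro x hx
    have : Submodule.span ℝ (coreCone A) ≤
        (Submodule.span ℝ (coreCone A)).comap A.mulVecLin := by
      refine Submodule.span_le.2 fun z hz => Submodule.subset_span (mem_coreCone.2 fun k => ?_)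
      obtain ⟨b, hb, rfl⟩ := mem_coreCone.1 hz k
      refine ⟨A.mulVec b, Matrix.mulVec_nonneg_of_nonneg hA hb, ?_⟩
      rw [Matrix.mulVecLin_apply, Matrix.mulVec_mulVec, Matrix.mulVec_mulVec, ← pow_succ,
        ← pow_succ']
    exact this hx
  have hsurj : Function.Surjective (A.mulVecLin.restrict hmap) := by
    have : Submodule.span ℝ (coreCone A) ≤ (Submodule.span ℝ (coreCone A)).map A.mulVecLin := by
      refine Submodule.span_le.2 fun z hz => ?_
      obtain ⟨y, hy, rfl⟩ := exists_backwardOrbit hA hcol hz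
      exact ⟨y 1, Submodule.subset_span (hy.mem_coreCone 1), hy.2 0⟩
    rintro ⟨z, hz⟩
    obtain ⟨w, hw, hwz⟩ := this hz
    exact ⟨⟨w, hw⟩, Subtype.ext hwz⟩
  have hinj := LinearMap.injective_iff_surjective.2 hsurj
  intro x hx y hy hxy
  have := @hinj ⟨x, Submodule.subset_span hx⟩ ⟨y, Submodule.subset_span hy⟩ (Subtype.ext hxy)
  exact congrArg Subtype.val this

theorem IsBackwardOrbit.unique (hA : ∀ i j, 0 ≤ A i j) (hcol : ∀ j, 1 ≤ ∑ i, A i j)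
    {y z : ℕ → Fin N → ℝ} (hy : IsBackwardOrbit A y) (hz : IsBackwardOrbit A z)
    (h : y 0 = z 0) (n : ℕ) : y n = z n := by
  induction n with
  | zero => exact h
  | succ n ih =>
    refine coreCone_mulVec_injOn hA hcol (hy.mem_coreCone _) (hz.mem_coreCone _) ?_
    rw [hy.2, hz.2, ih]

/-- The core of a nonnegative `N × N` matrix without zero columns is generated by `N` of its
elements. -/
theorem exists_generators_coreCone (hA : ∀ i j, 0 ≤ A i j) (hcol : ∀ j, 1 ≤ ∑ i, A i j) :
    ∃ u : Fin N → Fin N → ℝ, (∀ j, u j ∈ coreCone A) ∧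
      ∀ x ∈ coreCone A, ∃ l : Fin N → ℝ, (∀ j, 0 ≤ l j) ∧ x = ∑ j, l j • u j := by
  let U : Ultrafilter ℕ := hyperfilter ℕ
  have hU : (U : Filter ℕ) ≤ atTop := Nat.hyperfilter_le_atTop
  let s : ℕ → Fin N → ℝ := fun k j => ∑ i, (A ^ (k + 1)).mulVec (Pi.single j 1) i
  have hsingle : ∀ j i : Fin N, (0 : ℝ) ≤ (Pi.single j 1 : Fin N → ℝ) i := fun j => by
    have : (0 : Fin N → ℝ) ≤ Pi.single j 1 := Pi.single_nonneg.2 zero_le_one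
    exact this
  have hs : ∀ k j, 0 < s k j := fun k j => by
    have := Matrix.sum_le_sum_pow_mulVec hA hcol (k + 1) (hsingle j)
    rw [Fintype.sum_pi_single'] at this
    exact zero_lt_one.trans_le this
  let v : ℕ → Fin N → Fin N → ℝ := fun k j => (s k j)⁻¹ • Pi.single j 1
  have hv0 : ∀ k j i, 0 ≤ v k j i := fun k j i => mul_nonneg (inv_nonneg.2 (hs k j).le) (hsingle j i)
  have hv1 : ∀ k j, ∑ i, (A ^ (k + 1)).mulVec (v k j) i = 1 := fun k j => by
    simp only [v, Matrix.mulVec_smul, Pi.smul_apply, ← Finset.smul_sum]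
    exact inv_mul_cancel₀ (hs k j).ne'
  have hu : ∀ j, ∃ z : Fin N → ℝ, (∀ i, 0 ≤ z i) ∧
      Tendsto (fun k => (A ^ (k + 1)).mulVec (v k j)) U (𝓝 z) := fun j =>
    exists_ultrafilter_limit U
      (fun k => Matrix.mulVec_nonneg_of_nonneg (Matrix.pow_entries_nonneg hA _) (hv0 k j))
      (Eventually.of_forall fun k => (hv1 k j).le)
  choose u hu0 hu using hu
  refine ⟨u, fun j => mem_coreCone.2 fun n => ?_, fun x hx => ?_⟩
  · obtain ⟨w, hw0, hw⟩ := exists_ultrafilter_limit U (M := 1)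
      (y := fun k => (A ^ (k - n)).mulVec (v k j))
      (fun k => Matrix.mulVec_nonneg_of_nonneg (Matrix.pow_entries_nonneg hA _) (hv0 k j))
      (hU ((eventually_ge_atTop n).mono fun k hk => by
        have h := Matrix.sum_le_sum_pow_mulVec hA hcol (n + 1)
          (Matrix.mulVec_nonneg_of_nonneg (Matrix.pow_entries_nonneg hA (k - n)) (hv0 k j))
        rwa [Matrix.mulVec_mulVec, ← pow_add, show n + 1 + (k - n) = k + 1 by omega, hv1] at h))
    refine ⟨w, hw0, tendsto_nhds_unique_of_eventuallyEq (tendsto_mulVec _ hw) (hu j)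
      (hU ((eventually_ge_atTop n).mono fun k hk => ?_))⟩
    simp only [Matrix.mulVec_mulVec, ← pow_add]
    congr 2
    omega
  · choose b hb hbx using mem_coreCone.1 hx
    let l : ℕ → Fin N → ℝ := fun k j => s k j * b k j
    have hl0 : ∀ k j, 0 ≤ l k j := fun k j => mul_nonneg (hs k j).le (hb k j)
    have hdec : ∀ k, x = ∑ j, l k j • (A ^ (k + 1)).mulVec (v k j) := fun k => by
      have hbk : b k = ∑ j, l k j • v k j := by
        ext i
        simp only [l, v, Finset.sum_apply, Pi.smul_apply, smul_eq_mul, Pi.single_apply]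
        simp only [mul_ite, mul_one, mul_zero, Finset.sum_ite_eq, Finset.mem_univ, if_true]
        rw [mul_right_comm, mul_inv_cancel₀ (hs k i).ne', one_mul]
      conv_lhs => rw [← hbx k, hbk]
      rw [Matrix.mulVec_sum]
      simp only [Matrix.mulVec_smul]
    have hlsum : ∀ k, ∑ j, l k j = ∑ i, x i := fun k => by
      have := congrArg (fun y : Fin N → ℝ => ∑ i, y i) (hdec k)
      simp only [Finset.sum_apply, Pi.smul_apply] at this
      rw [this, Finset.sum_comm]
      refine Finset.sum_congr rfl fun j _ => ?_
      rw [← Finset.smul_sum, hv1, smul_eq_mul, mul_one]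
    obtain ⟨L, hL0, hL⟩ := exists_ultrafilter_limit U hl0
      (Eventually.of_forall fun k => (hlsum k).le)
    refine ⟨L, hL0, tendsto_nhds_unique (f := fun _ : ℕ => x) (l := U) tendsto_const_nhds ?_⟩
    have : Tendsto (fun k => ∑ j, l k j • (A ^ (k + 1)).mulVec (v k j)) U (𝓝 (∑ j, L j • u j)) :=
      tendsto_finsetSum _ fun j _ => ((tendsto_pi_nhds.1 hL j).smul (hu j))
    exact this.congr fun k => (hdec k).symm

theorem finite_normalized_extreme (hA : ∀ i j, 0 ≤ A i j) (hcol : ∀ j, 1 ≤ ∑ i, A i j)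
    (φ : (Fin N → ℝ) →ₗ[ℝ] ℝ) :
    { x | φ x = 1 ∧ IsExtremeRayVec (coreCone A) x }.Finite := by
  obtain ⟨u, hu, hgen⟩ := exists_generators_coreCone hA hcol
  refine (Set.finite_range fun j => (φ (u j))⁻¹ • u j).subset ?_
  rintro x ⟨hφ, hx, hx0, hext⟩
  obtain ⟨l, hl, hxl⟩ := hgen x hx
  obtain ⟨j, hj⟩ : ∃ j, l j • u j ≠ 0 := by
    by_contra! h
    exact hx0 (hxl.trans (Finset.sum_eq_zero fun j _ => h j))
  obtain ⟨a, -, ha⟩ := hext _ (coreCone_smul (hu j) (hl j)) _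
    (coreCone_sum (Finset.univ.erase j) fun i _ => coreCone_smul (hu i) (hl i))
    (hxl.trans (Finset.add_sum_erase _ _ (Finset.mem_univ j)).symm)
  have hla : l j * φ (u j) = a := by simpa [hφ] using congrArg φ ha
  have ha0 : a ≠ 0 := fun h => hj (by rw [ha, h, zero_smul])
  have hφu : φ (u j) ≠ 0 := fun h => ha0 (by rw [← hla, h, mul_zero])
  have hl0 : l j ≠ 0 := fun h => ha0 (by rw [← hla, h, zero_mul])
  refine ⟨j, ?_⟩
  have : l j • u j = l j • (φ (u j) • x) := by rw [ha, ← hla, mul_smul]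
  exact (inv_smul_eq_iff₀ hφu).2 (smul_right_injective _ hl0 this)

end CoreCone

namespace BratteliDiagram

open Filter Topology
open scoped ENNReal NNReal

section Paths

variable {B : BratteliDiagram}

theorem PathSpace.ext {x y : B.PathSpace} (h : ∀ i, x.1 i = y.1 i) : x = y :=
  Subtype.ext (funext h)

variable (B) in
theorem exists_path_through (n : ℕ) (e : B.E n) : ∃ x : B.PathSpace, x.1 n = e := by
  choose f hf using B.src_surj
  choose g hg using B.rng_surj
  have back : ∀ (m : ℕ) (x : ∀ i, B.E i),
      (∀ i, m ≤ i → B.rng i (x i) = B.src (i + 1) (x (i + 1))) →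
      ∃ y : B.PathSpace, ∀ i, m ≤ i → y.1 i = x i := by
    intro m
    induction m with
    | zero => exact fun x hx => ⟨⟨x, fun i => hx i i.zero_le⟩, fun _ _ => rfl⟩
    | succ m ih =>
      intro x hx
      obtain ⟨y, hy⟩ := ih (Function.update x m (g m (B.src (m + 1) (x (m + 1))))) (by
        intro i hi
        rcases hi.eq_or_lt with rfl | hi
        · rw [Function.update_self, Function.update_of_ne (by omega), hg]
        · rw [Function.update_of_ne (by omega), Function.update_of_ne (by omega)]
          exact hx i hi)
      exact ⟨y, fun i hi => by rw [hy i (by omega), Function.update_of_ne (by omega)]⟩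
  let d : ∀ i, B.E i := Function.update (fun i => Classical.arbitrary (B.E i)) n e
  let x : ∀ i, B.E i := fun i => Nat.rec (motive := fun i => B.E i) (d 0)
    (fun i xi => if i + 1 = n then d (i + 1) else f (i + 1) (B.rng i xi)) i
  have hxn : x n = e := by
    cases n with
    | zero => exact Function.update_self ..
    | succ n =>
      change (if n + 1 = n + 1 then d (n + 1) else _) = e
      rw [if_pos rfl]
      exact Function.update_self ..
  obtain ⟨y, hy⟩ := back n x (by
    intro i hi
    change _ = B.src (i + 1) (if i + 1 = n then d (i + 1) else f (i + 1) (B.rng i (x i)))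
    rw [if_neg (by omega), hf])
  exact ⟨y, (hy n le_rfl).trans hxn⟩

/-- An infinite path using the edge `e`. -/
noncomputable def through (n : ℕ) (e : B.E n) : B.PathSpace :=
  (B.exists_path_through n e).choose

@[simp] theorem through_apply (n : ℕ) (e : B.E n) : (through n e).1 n = e :=
  (B.exists_path_through n e).choose_spec

@[simp] theorem endVtx_through (n : ℕ) (e : B.E n) : B.endVtx n (through n e) = B.src n e :=
  congrArg (B.src n) (through_apply n e)

instance : Nonempty B.PathSpace := ⟨through 0 (Classical.arbitrary _)⟩

theorem endVtx_surjective (n : ℕ) : Function.Surjective (B.endVtx n) := fun v => by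
  obtain ⟨e, rfl⟩ := B.src_surj n v
  exact ⟨through n e, endVtx_through n e⟩

theorem endVtx_succ (n : ℕ) (x : B.PathSpace) : B.endVtx (n + 1) x = B.rng n (x.1 n) :=
  (x.2 n).symm

theorem mem_cyl_self (n : ℕ) (x : B.PathSpace) : x ∈ B.cyl n x := fun _ _ => rfl

theorem mem_cyl_comm {n : ℕ} {x y : B.PathSpace} : x ∈ B.cyl n y ↔ y ∈ B.cyl n x :=
  ⟨fun h i hi => (h i hi).symm, fun h i hi => (h i hi).symm⟩

theorem cyl_eq_of_mem {n : ℕ} {x y : B.PathSpace} (h : y ∈ B.cyl n x) :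
    B.cyl n y = B.cyl n x := by
  ext z
  exact forall₂_congr fun i hi => by rw [h i hi]

theorem cyl_anti {m n : ℕ} (h : m ≤ n) (x : B.PathSpace) : B.cyl n x ⊆ B.cyl m x :=
  fun _ hy i hi => hy i (hi.trans_le h)

theorem cyl_zero (x : B.PathSpace) : B.cyl 0 x = Set.univ :=
  Set.eq_univ_of_forall fun _ _ hi => absurd hi (Nat.not_lt_zero _)

theorem endVtx_eq_of_mem_cyl {n : ℕ} {x y : B.PathSpace} (h : y ∈ B.cyl n x) :
    B.endVtx n y = B.endVtx n x := by
  cases n with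
  | zero => exact B.root_subsingleton _ _
  | succ n => rw [endVtx_succ, endVtx_succ, h n n.lt_succ_self]

open scoped Classical in
/-- Replace the first `n` edges of `y` by those of `x`; if the two paths pass through different
vertices at level `n`, keep `y` unchanged. -/
noncomputable def splice (n : ℕ) (x y : B.PathSpace) : B.PathSpace :=
  if h : B.endVtx n x = B.endVtx n y then
    ⟨fun i => if i < n then x.1 i else y.1 i, fun i => by
      change B.rng i (if i < n then x.1 i else y.1 i) =
        B.src (i + 1) (if i + 1 < n then x.1 (i + 1) else y.1 (i + 1))
      rcases lt_trichotomy (i + 1) n with hi | hi | hi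
      · rw [if_pos hi, if_pos (show i < n by omega), x.2]
      · subst hi
        rw [if_pos i.lt_succ_self, if_neg (lt_irrefl _), x.2]
        exact h
      · rw [if_neg (show ¬i < n by omega), if_neg hi.not_gt, y.2]⟩
  else y

theorem splice_of_ne {n : ℕ} {x y : B.PathSpace} (h : B.endVtx n x ≠ B.endVtx n y) :
    splice n x y = y := dif_neg h

theorem splice_apply_of_lt {n i : ℕ} {x y : B.PathSpace} (h : B.endVtx n x = B.endVtx n y)
    (hi : i < n) : (splice n x y).1 i = x.1 i :=
  (congrArg (fun z : B.PathSpace => z.1 i) (dif_pos h)).trans (if_pos hi)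

theorem splice_apply_of_le {n i : ℕ} (x y : B.PathSpace) (hi : n ≤ i) :
    (splice n x y).1 i = y.1 i := by
  by_cases h : B.endVtx n x = B.endVtx n y
  · exact (congrArg (fun z : B.PathSpace => z.1 i) (dif_pos h)).trans (if_neg hi.not_gt)
  · rw [splice_of_ne h]

theorem splice_mem_cyl {n : ℕ} {x y : B.PathSpace} (h : B.endVtx n x = B.endVtx n y) :
    splice n x y ∈ B.cyl n x := fun _ hi => splice_apply_of_lt h hi

theorem endVtx_splice {n k : ℕ} (x y : B.PathSpace) (hk : n ≤ k) :
    B.endVtx k (splice n x y) = B.endVtx k y :=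
  congrArg (B.src k) (splice_apply_of_le x y hk)

theorem tailEq_splice (n : ℕ) (x y : B.PathSpace) : B.tailEq (splice n x y) y :=
  ⟨n, fun _ hi => splice_apply_of_le x y hi⟩

theorem splice_congr_left {n : ℕ} {x x' : B.PathSpace} (h : x' ∈ B.cyl n x) (y : B.PathSpace) :
    splice n x' y = splice n x y := by
  have he := endVtx_eq_of_mem_cyl h
  by_cases hy : B.endVtx n x = B.endVtx n y
  · refine PathSpace.ext fun i => ?_
    rcases lt_or_ge i n with hi | hi
    · rw [splice_apply_of_lt hy hi, splice_apply_of_lt (he.trans hy) hi, h i hi]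
    · rw [splice_apply_of_le _ _ hi, splice_apply_of_le _ _ hi]
  · rw [splice_of_ne hy, splice_of_ne (he ▸ hy)]

theorem splice_self_of_tail {n : ℕ} {x y : B.PathSpace} (h : ∀ i, n ≤ i → x.1 i = y.1 i) :
    splice n x y = x := by
  have hv : B.endVtx n x = B.endVtx n y := congrArg (B.src n) (h n le_rfl)
  refine PathSpace.ext fun i => ?_
  rcases lt_or_ge i n with hi | hi
  · rw [splice_apply_of_lt hv hi]
  · rw [splice_apply_of_le _ _ hi, h i hi]

theorem splice_splice_of_mem {n : ℕ} {x y z : B.PathSpace} (hz : z ∈ B.cyl n x) :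
    splice n x (splice n y z) = z := by
  rw [← splice_congr_left hz]
  exact splice_self_of_tail fun i hi => (splice_apply_of_le _ _ hi).symm

theorem mem_cyl_succ_splice {n : ℕ} {x y : B.PathSpace} {e : B.E n}
    (he : B.src n e = B.endVtx n x) :
    y ∈ B.cyl (n + 1) (splice n x (through n e)) ↔ y ∈ B.cyl n x ∧ y.1 n = e := by
  have hv : B.endVtx n x = B.endVtx n (through n e) := by rw [endVtx_through, he]
  constructor
  · intro h
    refine ⟨fun i hi => (h i (by omega)).trans (splice_apply_of_lt hv hi), ?_⟩
    rw [h n n.lt_succ_self, splice_apply_of_le _ _ le_rfl, through_apply]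
  · rintro ⟨h, h'⟩ i hi
    rcases (Nat.lt_succ_iff.1 hi).lt_or_eq with hi | rfl
    · rw [splice_apply_of_lt hv hi, h i hi]
    · rw [splice_apply_of_le _ _ le_rfl, through_apply, h']

end Paths

section Topology

variable {B : BratteliDiagram}

instance (n : ℕ) : DiscreteTopology (B.E n) := ⟨rfl⟩

instance : T2Space B.PathSpace :=
  inferInstanceAs (T2Space { x : ∀ n, B.E n // ∀ n, B.rng n (x n) = B.src (n + 1) (x (n + 1)) })

instance : SecondCountableTopology B.PathSpace :=
  have (n : ℕ) : SecondCountableTopology (B.E n) := Finite.toSecondCountableTopology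
  TopologicalSpace.secondCountableTopology_induced B.PathSpace (∀ n, B.E n) Subtype.val

instance : BorelSpace B.PathSpace := ⟨rfl⟩

theorem continuous_edge (i : ℕ) : Continuous fun x : B.PathSpace => x.1 i :=
  (continuous_apply i).comp continuous_subtype_val

instance : CompactSpace B.PathSpace := by
  refine isCompact_iff_compactSpace.1 (IsClosed.isCompact ?_)
  change IsClosed { x : ∀ n, B.E n | ∀ n, B.rng n (x n) = B.src (n + 1) (x (n + 1)) }
  rw [Set.ofPred_forall]
  refine isClosed_iInter fun n => ?_
  have : Continuous fun x : ∀ n, B.E n => (x n, x (n + 1)) := by fun_prop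
  exact (isClosed_discrete {p : B.E n × B.E (n + 1) | B.rng n p.1 = B.src (n + 1) p.2}).preimage
    this

theorem isClopen_cyl (n : ℕ) (x : B.PathSpace) : IsClopen (B.cyl n x) := by
  have : B.cyl n x = ⋂ i ∈ Set.Iio n, (fun y : B.PathSpace => y.1 i) ⁻¹' {x.1 i} := by
    ext y
    simp [cyl]
  rw [this]
  exact (Set.finite_Iio n).isClopen_biInter fun i _ =>
    (isClopen_discrete _).preimage (continuous_edge i)

theorem measurableSet_cyl (n : ℕ) (x : B.PathSpace) : MeasurableSet (B.cyl n x) :=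
  (isClopen_cyl n x).isOpen.measurableSet

theorem exists_cyl_subset {U : Set B.PathSpace} (hU : IsOpen U) {x : B.PathSpace} (hx : x ∈ U) :
    ∃ n, B.cyl n x ⊆ U := by
  obtain ⟨W, hW, rfl⟩ := isOpen_induced_iff.1 hU
  obtain ⟨I, u, hu, hIW⟩ := isOpen_pi_iff.1 hW x.1 hx
  refine ⟨I.sup id + 1, fun y hy => hIW fun i hi => ?_⟩
  rw [hy i (Nat.lt_succ_of_le (Finset.le_sup (f := id) hi))]
  exact (hu i hi).2

theorem continuous_splice (n : ℕ) (x : B.PathSpace) : Continuous (splice n x) := by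
  refine continuous_iff_continuousAt.2 fun y U hU => ?_
  obtain ⟨O, hOU, hO, hyO⟩ := mem_nhds_iff.1 hU
  obtain ⟨k, hk⟩ := exists_cyl_subset hO hyO
  refine mem_map.2 (mem_of_superset
    ((isClopen_cyl (max k (n + 1)) y).isOpen.mem_nhds (mem_cyl_self _ _)) fun z hz => hOU (hk ?_))
  have hv : B.endVtx n z = B.endVtx n y :=
    endVtx_eq_of_mem_cyl (cyl_anti (by omega) y hz)
  intro i hi
  by_cases hx : B.endVtx n x = B.endVtx n y
  · rcases lt_or_ge i n with hin | hin
    · rw [splice_apply_of_lt hx hin, splice_apply_of_lt (hx.trans hv.symm) hin]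
    · rw [splice_apply_of_le _ _ hin, splice_apply_of_le _ _ hin, hz i (by omega)]
  · rw [splice_of_ne hx, splice_of_ne (hv.symm ▸ hx), hz i (by omega)]

theorem measurable_splice (n : ℕ) (x : B.PathSpace) : Measurable (splice n x) :=
  (continuous_splice n x).measurable

theorem isTopologicalBasis_cyl :
    TopologicalSpace.IsTopologicalBasis { s | ∃ n, ∃ x : B.PathSpace, s = B.cyl n x } := by
  refine TopologicalSpace.isTopologicalBasis_of_isOpen_of_nhds ?_ fun x U hx hU => ?_
  · rintro _ ⟨n, x, rfl⟩
    exact (isClopen_cyl n x).isOpen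
  · obtain ⟨n, hn⟩ := exists_cyl_subset hU hx
    exact ⟨_, ⟨n, x, rfl⟩, mem_cyl_self n x, hn⟩

theorem isPiSystem_cyl : IsPiSystem { s | ∃ n, ∃ x : B.PathSpace, s = B.cyl n x } := by
  rintro _ ⟨n, x, rfl⟩ _ ⟨m, y, rfl⟩ ⟨z, hzx, hzy⟩
  refine ⟨max n m, z, ?_⟩
  rw [← cyl_eq_of_mem hzx, ← cyl_eq_of_mem hzy]
  ext w
  exact ⟨fun h i hi => (lt_max_iff.1 hi).elim (h.1 i) (h.2 i),
    fun h => ⟨cyl_anti (le_max_left _ _) z h, cyl_anti (le_max_right _ _) z h⟩⟩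

end Topology

section Measures

open scoped Classical

variable {B : BratteliDiagram}

theorem measure_cyl_eq_sum (μ : Measure B.PathSpace) (n : ℕ) (x : B.PathSpace) :
    μ (B.cyl n x) =
      ∑ e with B.src n e = B.endVtx n x, μ (B.cyl (n + 1) (splice n x (through n e))) := by
  rw [← measure_biUnion_finset]
  · congr 1
    ext y
    simp only [Finset.mem_filter, Finset.mem_univ, true_and, Set.mem_iUnion, exists_prop]
    constructor
    · intro h
      have : B.src n (y.1 n) = B.endVtx n x := endVtx_eq_of_mem_cyl h
      exact ⟨y.1 n, this, (mem_cyl_succ_splice this).2 ⟨h, rfl⟩⟩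
    · rintro ⟨e, he, h⟩
      exact ((mem_cyl_succ_splice he).1 h).1
  · intro e he e' he' hne
    refine Set.disjoint_left.2 fun y hy hy' => hne ?_
    rw [← ((mem_cyl_succ_splice (by simpa using he)).1 hy).2,
      ← ((mem_cyl_succ_splice (by simpa using he')).1 hy').2]
  · exact fun e _ => measurableSet_cyl _ _

theorem measure_ext_of_cyl {μ ν : Measure B.PathSpace} [IsFiniteMeasure μ] (m : ℕ)
    (h : ∀ k, m ≤ k → ∀ x, μ (B.cyl k x) = ν (B.cyl k x)) : μ = ν := by
  have key : ∀ d n, m ≤ n + d → ∀ x, μ (B.cyl n x) = ν (B.cyl n x) := by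
    intro d
    induction d with
    | zero => exact h
    | succ d ih =>
      intro n hn x
      rw [measure_cyl_eq_sum, measure_cyl_eq_sum]
      exact Finset.sum_congr rfl fun e _ => ih (n + 1) (by omega) _
  refine ext_of_generate_finite _ isTopologicalBasis_cyl.borel_eq_generateFrom isPiSystem_cyl ?_ ?_
  · rintro _ ⟨n, x, rfl⟩
    exact key m n (by omega) x
  · have x : B.PathSpace := Classical.arbitrary _
    rw [← cyl_zero x]
    exact key m 0 (by omega) x

/-- A consistent system of weights on the vertices: the weight of a vertex is the total weight
of the ranges of the edges leaving it. -/
def IsFlow (p : ∀ n, B.V n → ℝ≥0∞) : Prop :=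
  ∀ n w, p n w = ∑ e with B.src n e = w, p (n + 1) (B.rng n e)

/-- The measure obtained by splitting the cylinder `cyl n z` into its subcylinders of
length `n + k` and putting a point mass in each of them. -/
noncomputable def discreteApprox (p : ∀ n, B.V n → ℝ≥0∞) :
    ℕ → ℕ → B.PathSpace → Measure B.PathSpace
  | 0, n, z => p n (B.endVtx n z) • Measure.dirac z
  | k + 1, n, z => ∑ e with B.src n e = B.endVtx n z,
      discreteApprox p k (n + 1) (splice n z (through n e))

theorem discreteApprox_cyl {p : ∀ n, B.V n → ℝ≥0∞} (hp : IsFlow p) (k : ℕ) :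
    ∀ (n : ℕ) (z : B.PathSpace) (j : ℕ) (w : B.PathSpace), n ≤ j → j ≤ n + k →
      discreteApprox p k n z (B.cyl j w) = if w ∈ B.cyl n z then p j (B.endVtx j w) else 0 := by
  induction k with
  | zero =>
    intro n z j w hnj hjn
    obtain rfl : j = n := by omega
    rw [discreteApprox, Measure.smul_apply, Measure.dirac_apply' _ (measurableSet_cyl _ _),
      smul_eq_mul]
    split_ifs with h
    · rw [Set.indicator_of_mem (mem_cyl_comm.1 h), endVtx_eq_of_mem_cyl h]
      simp
    · rw [Set.indicator_of_notMem (fun h' => h (mem_cyl_comm.1 h')), mul_zero]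
  | succ k ih =>
    have hlt : ∀ (n : ℕ) (z : B.PathSpace) (j : ℕ) (w : B.PathSpace), n < j → j ≤ n + (k + 1) →
        discreteApprox p (k + 1) n z (B.cyl j w) =
          if w ∈ B.cyl n z then p j (B.endVtx j w) else 0 := by
      intro n z j w hnj hjn
      rw [discreteApprox, Measure.finsetSum_apply, Finset.sum_congr rfl
        (g := fun e => if w ∈ B.cyl n z ∧ w.1 n = e then p j (B.endVtx j w) else 0)]
      · split_ifs with h
        · simp only [h, true_and]
          rw [Finset.sum_ite_eq, if_pos]
          exact Finset.mem_filter.2 ⟨Finset.mem_univ _, endVtx_eq_of_mem_cyl h⟩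
        · simp [h]
      · intro e he
        rw [ih _ _ _ _ hnj (by omega), mem_cyl_succ_splice (by simpa using he)]
        congr
    intro n z j w hnj hjn
    rcases hnj.lt_or_eq with hnj | rfl
    · exact hlt n z j w hnj hjn
    · rw [measure_cyl_eq_sum, hp]
      have hw : ∀ e ∈ Finset.univ.filter (fun e => B.src n e = B.endVtx n w),
          discreteApprox p (k + 1) n z (B.cyl (n + 1) (splice n w (through n e))) =
            if w ∈ B.cyl n z then p (n + 1) (B.rng n e) else 0 := by
        intro e he
        have hs : splice n w (through n e) ∈ B.cyl n w :=
          splice_mem_cyl (by simpa [eq_comm] using he)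
        have hmem : splice n w (through n e) ∈ B.cyl n z ↔ w ∈ B.cyl n z := by
          rw [mem_cyl_comm, cyl_eq_of_mem hs, mem_cyl_comm]
        rw [hlt _ _ _ _ n.lt_succ_self (by omega), endVtx_succ,
          splice_apply_of_le _ _ le_rfl, through_apply]
        simp only [hmem]
      rw [Finset.sum_congr rfl hw]
      split_ifs <;> simp

/-- Every finite flow is the system of cylinder weights of a finite measure. -/
theorem IsFlow.exists_measure {p : ∀ n, B.V n → ℝ≥0∞} (hp : IsFlow p)
    (hfin : ∀ n v, p n v ≠ ∞) :
    ∃ μ : Measure B.PathSpace, IsFiniteMeasure μ ∧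
      ∀ n x, μ (B.cyl n x) = p n (B.endVtx n x) := by
  let x₀ : B.PathSpace := Classical.arbitrary _
  let U : Ultrafilter ℕ := hyperfilter ℕ
  have hU : (U : Filter ℕ) ≤ atTop := Nat.hyperfilter_le_atTop
  let μ : ℕ → Measure B.PathSpace := fun k => discreteApprox p k 0 x₀
  have hcyl : ∀ k j w, j ≤ k → μ k (B.cyl j w) = p j (B.endVtx j w) := fun k j w hj => by
    simp only [μ]
    rw [discreteApprox_cyl hp k 0 x₀ j w j.zero_le (by omega), if_pos]
    rw [cyl_zero]
    trivial
  have hlim : ∀ s : Set B.PathSpace, ∃ l : ℝ≥0∞, Tendsto (fun k => μ k s) U (𝓝 l) := fun s =>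
    ⟨_, (U.map fun k => μ k s).le_nhds_lim⟩
  choose L hL using hlim
  have hLcyl : ∀ j w, L (B.cyl j w) = p j (B.endVtx j w) := fun j w =>
    tendsto_nhds_unique_of_eventuallyEq (hL _) tendsto_const_nhds
      (hU ((eventually_ge_atTop j).mono fun k hk => hcyl k j w hk))
  have hmono : ∀ s t, s ⊆ t → L s ≤ L t := fun s t hst =>
    le_of_tendsto_of_tendsto' (hL s) (hL t) fun k => measure_mono hst
  have hLfin : ∀ s, L s ≠ ∞ := fun s => by
    refine ne_top_of_le_ne_top (hfin 0 (B.endVtx 0 x₀)) ?_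
    rw [← hLcyl, cyl_zero]
    exact hmono _ _ (Set.subset_univ s)
  let c : Content B.PathSpace :=
    { toFun := fun K => (L K).toNNReal
      mono' := fun K₁ K₂ h => ENNReal.toNNReal_mono (hLfin _) (hmono _ _ h)
      sup_disjoint' := fun K₁ K₂ h _ h₂ => by
        rw [← ENNReal.toNNReal_add (hLfin _) (hLfin _)]
        congr 1
        refine tendsto_nhds_unique (hL _) (((hL K₁).add (hL K₂)).congr fun k => ?_)
        rw [TopologicalSpace.Compacts.coe_sup, measure_union h h₂.measurableSet]
      sup_le' := fun K₁ K₂ => by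
        rw [← ENNReal.toNNReal_add (hLfin _) (hLfin _)]
        refine ENNReal.toNNReal_mono (ENNReal.add_ne_top.2 ⟨hLfin _, hLfin _⟩)
          (le_of_tendsto_of_tendsto' (hL _) ((hL K₁).add (hL K₂)) fun k => ?_)
        rw [TopologicalSpace.Compacts.coe_sup]
        exact measure_union_le _ _ }
  have hc : ∀ n x, c.measure (B.cyl n x) = p n (B.endVtx n x) := fun n x => by
    have hcl := isClopen_cyl n x
    rw [c.measure_apply (measurableSet_cyl n x), c.outerMeasure_of_isOpen _ hcl.isOpen,
      c.innerContent_of_isCompact hcl.isClosed.isCompact hcl.isOpen]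
    change ((L (B.cyl n x)).toNNReal : ℝ≥0∞) = _
    rw [ENNReal.coe_toNNReal (hLfin _), hLcyl]
  refine ⟨c.measure, ⟨?_⟩, hc⟩
  rw [← cyl_zero x₀, hc]
  exact (hfin _ _).lt_top

end Measures

section Ergodicity

variable {B : BratteliDiagram}

theorem TailInvariant.map_splice {μ : Measure B.PathSpace} [IsFiniteMeasure μ]
    (hμ : B.TailInvariant μ) {n : ℕ} {x y : B.PathSpace} (h : B.endVtx n x = B.endVtx n y) :
    (μ.restrict (B.cyl n x)).map (splice n y) = μ.restrict (B.cyl n y) := by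
  refine measure_ext_of_cyl n fun k hk w => ?_
  rw [Measure.map_apply (measurable_splice n y) (measurableSet_cyl k w),
    Measure.restrict_apply (measurable_splice n y (measurableSet_cyl k w)),
    Measure.restrict_apply (measurableSet_cyl k w)]
  by_cases hw : w ∈ B.cyl n y
  · have hv : B.endVtx n x = B.endVtx n w := h.trans (endVtx_eq_of_mem_cyl hw).symm
    have h₁ : splice n y ⁻¹' B.cyl k w ∩ B.cyl n x = B.cyl k (splice n x w) := by
      ext z
      constructor
      · rintro ⟨hz, hzx⟩ i hi
        by_cases hin : i < n
        · rw [splice_apply_of_lt hv hin, hzx i hin]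
        · rw [splice_apply_of_le x w (not_lt.1 hin), ← hz i hi,
            splice_apply_of_le y z (not_lt.1 hin)]
      · intro hz
        have hzx : z ∈ B.cyl n x := fun i hi => by
          rw [hz i (hi.trans_le hk), splice_apply_of_lt hv hi]
        refine ⟨fun i hi => ?_, hzx⟩
        by_cases hin : i < n
        · rw [splice_apply_of_lt (h.symm.trans (endVtx_eq_of_mem_cyl hzx).symm) hin, hw i hin]
        · rw [splice_apply_of_le y z (not_lt.1 hin), hz i hi,
            splice_apply_of_le x w (not_lt.1 hin)]
    have h₂ : B.cyl k w ∩ B.cyl n y = B.cyl k w := by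
      refine Set.inter_eq_left.2 fun z hz i hi => ?_
      rw [hz i (hi.trans_le hk), hw i hi]
    rw [h₁, h₂]
    exact hμ k _ _ (endVtx_splice x w hk)
  · have h₁ : splice n y ⁻¹' B.cyl k w ∩ B.cyl n x = ∅ := by
      refine Set.eq_empty_of_forall_notMem fun z ⟨hz, hzx⟩ => hw fun i hi => ?_
      rw [← hz i (hi.trans_le hk),
        splice_apply_of_lt (h.symm.trans (endVtx_eq_of_mem_cyl hzx).symm) hi]
    have h₂ : B.cyl k w ∩ B.cyl n y = ∅ :=
      Set.eq_empty_of_forall_notMem fun z ⟨hz, hzy⟩ => hw fun i hi => by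
        rw [← hz i (hi.trans_le hk), hzy i hi]
    rw [h₁, h₂]

theorem TailInvariant.measure_splice_preimage {μ : Measure B.PathSpace} [IsFiniteMeasure μ]
    (hμ : B.TailInvariant μ) {n : ℕ} {x y : B.PathSpace} (h : B.endVtx n x = B.endVtx n y)
    {s : Set B.PathSpace} (hs : MeasurableSet s) :
    μ (splice n y ⁻¹' s ∩ B.cyl n x) = μ (s ∩ B.cyl n y) := by
  rw [← Measure.restrict_apply (measurable_splice n y hs),
    ← Measure.map_apply (measurable_splice n y) hs, hμ.map_splice h, Measure.restrict_apply hs]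

theorem tailEq_comm {x y : B.PathSpace} : B.tailEq x y ↔ B.tailEq y x :=
  ⟨fun ⟨n, h⟩ => ⟨n, fun i hi => (h i hi).symm⟩, fun ⟨n, h⟩ => ⟨n, fun i hi => (h i hi).symm⟩⟩

theorem TailInvariant.restrict {μ : Measure B.PathSpace} [IsFiniteMeasure μ]
    (hμ : B.TailInvariant μ) {S : Set B.PathSpace} (hS : MeasurableSet S)
    (hinv : ∀ x y, B.tailEq x y → (x ∈ S ↔ y ∈ S)) : B.TailInvariant (μ.restrict S) := by
  intro n x y h
  have hpre : splice n y ⁻¹' S = S := by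
    ext z
    exact hinv _ _ (tailEq_splice n y z)
  rw [Measure.restrict_apply (measurableSet_cyl n x), Measure.restrict_apply (measurableSet_cyl n y),
    Set.inter_comm, Set.inter_comm (B.cyl n y), ← hμ.measure_splice_preimage h hS, hpre]

theorem rnDeriv_comp_splice_ae_eq {μ ν : Measure B.PathSpace} [IsFiniteMeasure μ]
    [IsFiniteMeasure ν] (hμ : B.TailInvariant μ) (hν : B.TailInvariant ν) (hac : ν ≪ μ)
    (n : ℕ) (x : B.PathSpace) :
    (fun z => ν.rnDeriv μ (splice n x z)) =ᵐ[μ] ν.rnDeriv μ := by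
  have hf := Measure.measurable_rnDeriv ν μ
  have hset : ∀ s, MeasurableSet s → ∫⁻ z in s, ν.rnDeriv μ z ∂μ = ν s := fun s hs => by
    rw [← withDensity_apply _ hs, Measure.withDensity_rnDeriv_eq ν μ hac]
  have hloc : ∀ y, (fun z => ν.rnDeriv μ (splice n x z)) =ᵐ[μ.restrict (B.cyl n y)]
      ν.rnDeriv μ := fun y => by
    by_cases h : B.endVtx n x = B.endVtx n y
    · refine ae_eq_of_forall_setLIntegral_eq_of_sigmaFinite
        (hf.comp (measurable_splice n x)) hf fun s hs _ => ?_
      have hs' := measurable_splice n y hs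
      calc ∫⁻ z in s, ν.rnDeriv μ (splice n x z) ∂μ.restrict (B.cyl n y)
          = ∫⁻ z in splice n y ⁻¹' s, ν.rnDeriv μ (splice n x (splice n y z))
              ∂μ.restrict (B.cyl n x) := by
            rw [← hμ.map_splice h]
            exact setLIntegral_map hs (hf.comp (measurable_splice n x)) (measurable_splice n y)
        _ = ∫⁻ z in splice n y ⁻¹' s ∩ B.cyl n x, ν.rnDeriv μ z ∂μ := by
            rw [Measure.restrict_restrict hs']
            refine setLIntegral_congr_fun (hs'.inter (measurableSet_cyl n x)) fun z hz => ?_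
            simp only [splice_splice_of_mem hz.2]
        _ = ∫⁻ z in s, ν.rnDeriv μ z ∂μ.restrict (B.cyl n y) := by
            rw [hset _ (hs'.inter (measurableSet_cyl n x)), hν.measure_splice_preimage h hs,
              Measure.restrict_restrict hs, hset _ (hs.inter (measurableSet_cyl n y))]
    · refine (ae_restrict_mem (measurableSet_cyl n y)).mono fun z hz => ?_
      simp only [splice_of_ne fun h' => h (h'.trans (endVtx_eq_of_mem_cyl hz))]
  refine measure_null_of_locally_null _ fun y _ =>
    ⟨_, inter_mem_nhdsWithin _ ((isClopen_cyl n y).isOpen.mem_nhds (mem_cyl_self n y)), ?_⟩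
  have := hloc y
  rw [EventuallyEq, ae_restrict_iff' (measurableSet_cyl n y)] at this
  rw [ae_iff] at this
  refine measure_mono_null (fun z hz => ?_) this
  exact fun hc => hz.1 (hc hz.2)

theorem TailErgodic.exists_eq_smul {μ ν : Measure B.PathSpace} [IsFiniteMeasure μ]
    (hμ : B.TailInvariant μ) (herg : B.TailErgodic μ) (hν : B.TailInvariant ν) (hle : ν ≤ μ) :
    ∃ c : ℝ≥0∞, ν = c • μ := by
  have : IsFiniteMeasure ν := isFiniteMeasure_of_le μ hle
  have hac : ν ≪ μ := Measure.absolutelyContinuous_of_le hle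
  set f := ν.rnDeriv μ with hfdef
  have hf : Measurable f := Measure.measurable_rnDeriv ν μ
  let d := TopologicalSpace.denseSeq B.PathSpace
  let g : B.PathSpace → ℝ≥0∞ := fun z => ⨆ n, ⨆ k, f (splice n (d k) z)
  have hg : Measurable g :=
    .iSup fun n => .iSup fun k => hf.comp (measurable_splice n (d k))
  have hgle : ∀ z w, B.tailEq z w → g z ≤ g w := fun z w ⟨M, hM⟩ => by
    refine iSup_le fun n => iSup_le fun k => ?_
    set u := splice n (d k) z
    obtain ⟨_, hv, l, rfl⟩ := (TopologicalSpace.denseRange_denseSeq B.PathSpace).inter_open_nonempty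
      _ (isClopen_cyl (max n M) u).isOpen ⟨u, mem_cyl_self _ u⟩
    have hu : splice (max n M) (d l) w = u := by
      rw [splice_congr_left hv w]
      refine splice_self_of_tail fun i hi => ?_
      rw [splice_apply_of_le _ _ ((le_max_left _ _).trans hi), hM i ((le_max_right _ _).trans hi)]
    exact le_iSup₂_of_le (max n M) l (by rw [hu])
  have hginv : ∀ z w, B.tailEq z w → g z = g w := fun z w h =>
    le_antisymm (hgle z w h) (hgle w z (tailEq_comm.1 h))
  have hgf : g =ᵐ[μ] f := by
    have : ∀ᵐ z ∂μ, ∀ n k, f (splice n (d k) z) = f z :=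
      ae_all_iff.2 fun n => ae_all_iff.2 fun k => rnDeriv_comp_splice_ae_eq hμ hν hac n (d k)
    filter_upwards [this] with z hz
    simp only [g, hz, ciSup_const]
  obtain ⟨c, hc⟩ : ∃ c, g =ᵐ[μ] Function.const _ c := by
    refine exists_eventuallyEq_const_of_forall_separating MeasurableSet fun U hU => ?_
    rcases herg (g ⁻¹' U) (hg hU) (fun x y h => by simp only [Set.mem_preimage, hginv x y h])
      with h | h
    · exact Or.inr (measure_eq_zero_iff_ae_notMem.1 h)
    · exact Or.inl h
  refine ⟨c, ?_⟩
  rw [← Measure.withDensity_rnDeriv_eq ν μ hac, withDensity_congr_ae (hgf.symm.trans hc)]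
  exact withDensity_const c

end Ergodicity

section Weights

open scoped Classical

variable {B : BratteliDiagram}

/-- The measure of some cylinder ending at the vertex `v`. -/
noncomputable def weight (μ : Measure B.PathSpace) (n : ℕ) (v : B.V n) : ℝ≥0∞ :=
  μ (B.cyl n (endVtx_surjective n v).choose)

theorem TailInvariant.measure_cyl {μ : Measure B.PathSpace} (hμ : B.TailInvariant μ) (n : ℕ)
    (x : B.PathSpace) : μ (B.cyl n x) = weight μ n (B.endVtx n x) :=
  hμ n _ _ (endVtx_surjective n (B.endVtx n x)).choose_spec.symm

theorem tailInvariant_of_measure_cyl {μ : Measure B.PathSpace} {p : ∀ n, B.V n → ℝ≥0∞}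
    (h : ∀ n x, μ (B.cyl n x) = p n (B.endVtx n x)) : B.TailInvariant μ :=
  fun n x y hxy => by rw [h, h, hxy]

theorem weight_eq_of_measure_cyl {μ : Measure B.PathSpace} {p : ∀ n, B.V n → ℝ≥0∞}
    (h : ∀ n x, μ (B.cyl n x) = p n (B.endVtx n x)) (n : ℕ) (v : B.V n) : weight μ n v = p n v := by
  rw [weight, h, (endVtx_surjective n v).choose_spec]

theorem weight_ne_top (μ : Measure B.PathSpace) [IsFiniteMeasure μ] (n : ℕ) (v : B.V n) :
    weight μ n v ≠ ∞ := measure_ne_top μ _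

theorem TailInvariant.isFlow_weight {μ : Measure B.PathSpace} (hμ : B.TailInvariant μ) :
    IsFlow (weight μ) := by
  intro n w
  obtain ⟨x, rfl⟩ := endVtx_surjective n w
  rw [← hμ.measure_cyl, measure_cyl_eq_sum]
  refine Finset.sum_congr rfl fun e _ => ?_
  rw [hμ.measure_cyl, endVtx_splice _ _ n.le_succ, endVtx_succ, through_apply]

theorem sum_filter_src_eq {M : Type*} [AddCommMonoid M] (n : ℕ) (w : B.V n)
    (g : B.V (n + 1) → M) :
    ∑ e with B.src n e = w, g (B.rng n e) = ∑ v, B.edgeCount n v w • g v := by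
  rw [← Finset.sum_fiberwise _ (B.rng n)]
  refine Finset.sum_congr rfl fun v _ => ?_
  rw [Finset.sum_congr rfl fun e he => by rw [(Finset.mem_filter.1 he).2], Finset.sum_const,
    edgeCount, Nat.card_eq_fintype_card, Fintype.card_subtype, Finset.filter_filter]
  simp only [and_comm]

theorem isFlow_iff {p : ∀ n, B.V n → ℝ≥0∞} :
    IsFlow p ↔ ∀ n w, p n w = ∑ v, (B.edgeCount n v w : ℝ≥0∞) * p (n + 1) v := by
  refine forall₂_congr fun n w => ?_
  rw [sum_filter_src_eq n w (p (n + 1))]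
  simp only [nsmul_eq_mul]

theorem height_one (v : B.V 1) (w : B.V 0) : B.height 1 v = B.edgeCount 0 v w :=
  Nat.card_congr
    { toFun := fun q => ⟨q.1.1, q.1.2, B.root_subsingleton _ _⟩
      invFun := fun e => ⟨⟨e.1, e.2.1⟩, PUnit.unit⟩
      left_inv := fun _ => rfl
      right_inv := fun _ => rfl }

theorem edgeCount_pos (n : ℕ) (e : B.E n) : 0 < B.edgeCount n (B.rng n e) (B.src n e) := by
  have : Nonempty { e' : B.E n // B.rng n e' = B.rng n e ∧ B.src n e' = B.src n e } :=
    ⟨⟨e, rfl, rfl⟩⟩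
  exact Nat.card_pos

theorem height_one_pos (v : B.V 1) : 0 < B.height 1 v := by
  obtain ⟨e, rfl⟩ := B.rng_surj 0 v
  rw [height_one _ (B.src 0 e)]
  exact edgeCount_pos 0 e

theorem TailInvariant.measure_endVtx_one {μ : Measure B.PathSpace} (hμ : B.TailInvariant μ)
    (w : B.V 1) : μ { x | B.endVtx 1 x = w } = B.height 1 w * weight μ 1 w := by
  have x : B.PathSpace := Classical.arbitrary _
  have h := measure_cyl_eq_sum (μ.restrict { x | B.endVtx 1 x = w }) 0 x
  rw [cyl_zero, Measure.restrict_apply_univ] at h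
  rw [h, height_one w (B.endVtx 0 x)]
  calc _ = ∑ e with B.src 0 e = B.endVtx 0 x, if B.rng 0 e = w then weight μ 1 w else 0 := by
        refine Finset.sum_congr rfl fun e _ => ?_
        have he : B.endVtx 1 (splice 0 x (through 0 e)) = B.rng 0 e := by
          rw [endVtx_splice _ _ (Nat.zero_le 1), endVtx_succ, through_apply]
        rw [Measure.restrict_apply (measurableSet_cyl _ _)]
        split_ifs with hw
        · rw [← hw, ← he, ← hμ.measure_cyl, Set.inter_eq_left.2]
          exact fun y hy => endVtx_eq_of_mem_cyl hy
        · rw [← measure_empty (μ := μ)]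
          congr 1
          exact Set.eq_empty_of_forall_notMem fun y hy =>
            hw (he.symm.trans ((endVtx_eq_of_mem_cyl hy.1).symm.trans hy.2))
    _ = _ := by
        rw [sum_filter_src_eq 0 (B.endVtx 0 x) fun v => if v = w then weight μ 1 w else 0]
        simp

theorem TailInvariant.measure_univ_eq {μ : Measure B.PathSpace} (hμ : B.TailInvariant μ) :
    μ Set.univ = ∑ w, (B.height 1 w : ℝ≥0∞) * weight μ 1 w := by
  have x : B.PathSpace := Classical.arbitrary _
  rw [← cyl_zero x, hμ.measure_cyl, isFlow_iff.1 hμ.isFlow_weight]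
  exact Finset.sum_congr rfl fun w _ => by rw [height_one w (B.endVtx 0 x)]

theorem TailInvariant.add {μ ν : Measure B.PathSpace} (hμ : B.TailInvariant μ)
    (hν : B.TailInvariant ν) : B.TailInvariant (μ + ν) := fun n x y h => by
  rw [Measure.add_apply, Measure.add_apply, hμ n x y h, hν n x y h]

theorem TailInvariant.smul {μ : Measure B.PathSpace} (hμ : B.TailInvariant μ) (c : ℝ≥0∞) :
    B.TailInvariant (c • μ) := fun n x y h => by
  rw [Measure.smul_apply, Measure.smul_apply, hμ n x y h]

/-- The vector of the measures of the cylinders of length one, indexed by their end vertices. -/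
noncomputable def levelOneVec {N : ℕ} (i₀ : B.V 1 ≃ Fin N) (μ : Measure B.PathSpace) :
    Fin N → ℝ := fun i =>
  (μ { x : B.PathSpace | B.endVtx 1 x = i₀.symm i }).toReal / (B.height 1 (i₀.symm i) : ℝ)

variable {N : ℕ} (i₀ : B.V 1 ≃ Fin N)

theorem TailInvariant.levelOneVec_apply {μ : Measure B.PathSpace} (hμ : B.TailInvariant μ)
    (i : Fin N) : levelOneVec i₀ μ i = (weight μ 1 (i₀.symm i)).toReal := by
  have : (B.height 1 (i₀.symm i) : ℝ) ≠ 0 := Nat.cast_ne_zero.2 (height_one_pos _).ne'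
  rw [levelOneVec, hμ.measure_endVtx_one, ENNReal.toReal_mul, ENNReal.toReal_natCast,
    mul_div_cancel_left₀ _ this]

theorem levelOneVec_add (μ ν : Measure B.PathSpace) [IsFiniteMeasure μ] [IsFiniteMeasure ν] :
    levelOneVec i₀ (μ + ν) = levelOneVec i₀ μ + levelOneVec i₀ ν := by
  ext i
  rw [Pi.add_apply, levelOneVec, levelOneVec, levelOneVec, Measure.add_apply,
    ENNReal.toReal_add (measure_ne_top _ _) (measure_ne_top _ _), add_div]

theorem levelOneVec_smul (c : ℝ≥0∞) (μ : Measure B.PathSpace) :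
    levelOneVec i₀ (c • μ) = c.toReal • levelOneVec i₀ μ := by
  ext i
  rw [Pi.smul_apply, levelOneVec, levelOneVec, Measure.smul_apply, smul_eq_mul, smul_eq_mul,
    ENNReal.toReal_mul, mul_div_assoc]

theorem TailInvariant.sum_height_mul_levelOneVec {μ : Measure B.PathSpace} [IsFiniteMeasure μ]
    (hμ : B.TailInvariant μ) :
    ∑ w, (B.height 1 w : ℝ) * levelOneVec i₀ μ (i₀ w) = (μ Set.univ).toReal := by
  rw [hμ.measure_univ_eq, ENNReal.toReal_sum fun w _ =>
    ENNReal.mul_ne_top (ENNReal.natCast_ne_top _) (weight_ne_top μ 1 w)]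
  refine Finset.sum_congr rfl fun w _ => ?_
  rw [hμ.levelOneVec_apply, i₀.symm_apply_apply, ENNReal.toReal_mul, ENNReal.toReal_natCast]

end Weights

section Stationary

variable {B : BratteliDiagram} {N : ℕ} {ident : ∀ n, B.V (n + 1) ≃ Fin N}
  {F : Matrix (Fin N) (Fin N) ℝ}

/-- `F` is the common incidence matrix at all levels `n ≥ 1`, the vertices being identified with
indices through `ident`. -/
def IsStationary (ident : ∀ n, B.V (n + 1) ≃ Fin N) (F : Matrix (Fin N) (Fin N) ℝ) : Prop :=
  ∀ (n : ℕ) (v : B.V (n + 2)) (w : B.V (n + 1)),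
    F (ident (n + 1) v) (ident n w) = (B.edgeCount (n + 1) v w : ℝ)

theorem IsStationary.transpose_nonneg (hF : IsStationary ident F) (i j : Fin N) :
    0 ≤ F.transpose i j := by
  have := hF 0 ((ident 1).symm j) ((ident 0).symm i)
  rw [Equiv.apply_symm_apply, Equiv.apply_symm_apply] at this
  rw [Matrix.transpose_apply, this]
  exact Nat.cast_nonneg _

theorem IsStationary.one_le_sum_transpose (hF : IsStationary ident F) (j : Fin N) :
    1 ≤ ∑ i, F.transpose i j := by
  obtain ⟨e, he⟩ := B.rng_surj 1 ((ident 1).symm j)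
  have hj : j = ident 1 (B.rng 1 e) := by rw [he, Equiv.apply_symm_apply]
  refine le_trans ?_ (Finset.single_le_sum (fun i _ => hF.transpose_nonneg i j)
    (Finset.mem_univ (ident 0 (B.src 1 e))))
  rw [Matrix.transpose_apply, hj]
  exact (Nat.one_le_cast.2 (edgeCount_pos 1 e)).trans_eq (hF 0 _ _).symm

theorem IsStationary.mulVec_apply (hF : IsStationary ident F) (y : Fin N → ℝ) (n : ℕ)
    (w : B.V (n + 1)) : F.transpose.mulVec y (ident n w) =
      ∑ v, (B.edgeCount (n + 1) v w : ℝ) * y (ident (n + 1) v) := by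
  rw [Matrix.mulVec, dotProduct, ← Equiv.sum_comp (ident (n + 1))]
  exact Finset.sum_congr rfl fun v _ => by rw [Matrix.transpose_apply, hF]

theorem IsStationary.isBackwardOrbit (hF : IsStationary ident F) {p : ∀ n, B.V n → ℝ≥0∞}
    (hp : IsFlow p) (hfin : ∀ n v, p n v ≠ ∞) :
    IsBackwardOrbit F.transpose fun n i => (p (n + 1) ((ident n).symm i)).toReal := by
  refine ⟨fun _ _ => ENNReal.toReal_nonneg, fun n => funext fun i => ?_⟩
  obtain ⟨w, rfl⟩ := (ident n).surjective i
  rw [hF.mulVec_apply]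
  beta_reduce
  rw [Equiv.symm_apply_apply, isFlow_iff.1 hp, ENNReal.toReal_sum fun v _ =>
    ENNReal.mul_ne_top (ENNReal.natCast_ne_top _) (hfin _ v)]
  refine Finset.sum_congr rfl fun v _ => ?_
  rw [Equiv.symm_apply_apply, ENNReal.toReal_mul, ENNReal.toReal_natCast]

theorem IsStationary.isBackwardOrbit_weight (hF : IsStationary ident F) {μ : Measure B.PathSpace}
    [IsFiniteMeasure μ] (hμ : B.TailInvariant μ) :
    IsBackwardOrbit F.transpose fun n i => (weight μ (n + 1) ((ident n).symm i)).toReal :=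
  hF.isBackwardOrbit hμ.isFlow_weight (weight_ne_top μ)

theorem IsStationary.levelOneVec_mem_coreCone (hF : IsStationary ident F)
    {μ : Measure B.PathSpace} [IsFiniteMeasure μ] (hμ : B.TailInvariant μ) :
    levelOneVec (ident 0) μ ∈ coreCone F.transpose := by
  rw [show levelOneVec (ident 0) μ = _ from funext (hμ.levelOneVec_apply (ident 0))]
  exact (hF.isBackwardOrbit_weight hμ).mem_coreCone 0

theorem IsStationary.eq_of_levelOneVec_eq (hF : IsStationary ident F)
    {μ ν : Measure B.PathSpace} [IsFiniteMeasure μ] [IsFiniteMeasure ν] (hμ : B.TailInvariant μ)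
    (hν : B.TailInvariant ν) (h : levelOneVec (ident 0) μ = levelOneVec (ident 0) ν) : μ = ν := by
  have h₀ : (fun i => (weight μ 1 ((ident 0).symm i)).toReal) =
      fun i => (weight ν 1 ((ident 0).symm i)).toReal := by
    simpa only [← hμ.levelOneVec_apply, ← hν.levelOneVec_apply] using h
  have huniq := (hF.isBackwardOrbit_weight hμ).unique hF.transpose_nonneg hF.one_le_sum_transpose
    (hF.isBackwardOrbit_weight hν) h₀
  refine measure_ext_of_cyl 1 fun k hk x => ?_
  obtain ⟨k, rfl⟩ := Nat.exists_eq_add_of_le' hk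
  have := congrFun (huniq k) (ident k (B.endVtx (k + 1) x))
  rw [Equiv.symm_apply_apply] at this
  rw [hμ.measure_cyl, hν.measure_cyl]
  exact (ENNReal.toReal_eq_toReal_iff' (weight_ne_top μ _ _) (weight_ne_top ν _ _)).1 this

/-- The vertex weights given by a backward orbit of the transposed incidence matrix. -/
noncomputable def orbitFlow (ident : ∀ n, B.V (n + 1) ≃ Fin N) (y : ℕ → Fin N → ℝ) :
    ∀ n, B.V n → ℝ≥0∞
  | 0, _ => ENNReal.ofReal (∑ w, (B.height 1 w : ℝ) * y 0 (ident 0 w))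
  | n + 1, v => ENNReal.ofReal (y n (ident n v))

theorem IsStationary.isFlow_orbitFlow (hF : IsStationary ident F) {y : ℕ → Fin N → ℝ}
    (hy : IsBackwardOrbit F.transpose y) : IsFlow (orbitFlow ident y) := by
  refine isFlow_iff.2 fun n w => ?_
  have key : orbitFlow ident y n w =
      ENNReal.ofReal (∑ v, (B.edgeCount n v w : ℝ) * y n (ident n v)) := by
    cases n with
    | zero => simp only [orbitFlow, height_one _ w]
    | succ n => rw [← hF.mulVec_apply, hy.2, orbitFlow]
  rw [key, ENNReal.ofReal_sum_of_nonneg fun v _ => mul_nonneg (Nat.cast_nonneg _) (hy.1 n _)]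
  refine Finset.sum_congr rfl fun v _ => ?_
  rw [ENNReal.ofReal_mul (Nat.cast_nonneg _), ENNReal.ofReal_natCast, orbitFlow]

theorem IsStationary.exists_levelOneVec_eq (hF : IsStationary ident F) {x : Fin N → ℝ}
    (hx : x ∈ coreCone F.transpose) : ∃ μ : Measure B.PathSpace, IsFiniteMeasure μ ∧
      B.TailInvariant μ ∧ levelOneVec (ident 0) μ = x := by
  obtain ⟨y, hy, rfl⟩ := exists_backwardOrbit hF.transpose_nonneg hF.one_le_sum_transpose hx
  obtain ⟨μ, hfin, hμ⟩ := (hF.isFlow_orbitFlow hy).exists_measure fun n v => by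
    cases n <;> exact ENNReal.ofReal_ne_top
  have hinv := tailInvariant_of_measure_cyl hμ
  refine ⟨μ, hfin, hinv, funext fun i => ?_⟩
  rw [hinv.levelOneVec_apply, weight_eq_of_measure_cyl hμ, orbitFlow, Equiv.apply_symm_apply,
    ENNReal.toReal_ofReal (hy.1 0 i)]

theorem IsStationary.isExtremeRayVec_of_tailErgodic (hF : IsStationary ident F)
    {μ : Measure B.PathSpace} [IsFiniteMeasure μ] (hμ0 : μ ≠ 0) (hμ : B.TailInvariant μ)
    (herg : B.TailErgodic μ) :
    IsExtremeRayVec (coreCone F.transpose) (levelOneVec (ident 0) μ) := by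
  refine ⟨hF.levelOneVec_mem_coreCone hμ, fun h0 => hμ0 ?_, fun y hy z hz hyz => ?_⟩
  · have h := hμ.sum_height_mul_levelOneVec (ident 0)
    simp only [h0, Pi.zero_apply, mul_zero, Finset.sum_const_zero] at h
    exact Measure.measure_univ_eq_zero.1
      ((ENNReal.toReal_eq_zero_iff _).1 h.symm |>.resolve_right (measure_ne_top _ _))
  · obtain ⟨ν, _, hν, rfl⟩ := hF.exists_levelOneVec_eq hy
    obtain ⟨ρ, _, hρ, rfl⟩ := hF.exists_levelOneVec_eq hz
    have hsum : μ = ν + ρ :=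
      hF.eq_of_levelOneVec_eq hμ (hν.add hρ) (hyz.trans (levelOneVec_add (ident 0) ν ρ).symm)
    obtain ⟨c, hc⟩ := herg.exists_eq_smul hμ hν (hsum ▸ Measure.le_add_right le_rfl)
    refine ⟨c.toReal, ENNReal.toReal_nonneg, ?_⟩
    rw [← levelOneVec_smul, ← hc]

theorem IsStationary.tailErgodic_of_isExtremeRayVec (hF : IsStationary ident F)
    {μ : Measure B.PathSpace} [IsFiniteMeasure μ] (hμ : B.TailInvariant μ)
    (hext : IsExtremeRayVec (coreCone F.transpose) (levelOneVec (ident 0) μ)) :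
    B.TailErgodic μ := by
  intro S hS hinv
  have hS₁ := hμ.restrict hS hinv
  have hS₂ := hμ.restrict hS.compl fun x y h => not_congr (hinv x y h)
  obtain ⟨a, ha, haS⟩ := hext.2.2 _ (hF.levelOneVec_mem_coreCone hS₁) _
    (hF.levelOneVec_mem_coreCone hS₂)
    (by rw [← levelOneVec_add, Measure.restrict_add_restrict_compl hS])
  have hfin : IsFiniteMeasure (ENNReal.ofReal a • μ) := μ.smul_finite ENNReal.ofReal_ne_top
  have heq : μ.restrict S = ENNReal.ofReal a • μ :=
    hF.eq_of_levelOneVec_eq hS₁ (hμ.smul _) <| by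
      rw [haS, levelOneVec_smul, ENNReal.toReal_ofReal ha]
  have hcompl : 0 = ENNReal.ofReal a * μ Sᶜ := by
    rw [← smul_eq_mul, ← Measure.smul_apply, ← heq, Measure.restrict_apply hS.compl,
      Set.compl_inter_self, measure_empty]
  rcases mul_eq_zero.1 hcompl.symm with h | h
  · left
    rw [← Measure.restrict_apply_self, heq, Measure.smul_apply, h, zero_smul]
  · exact Or.inr h

end Stationary

end BratteliDiagram

/-- **Bezuglyi–Kwiatkowski–Medynets–Solomyak.** For a stationary Bratteli diagram with
aperiodic tail equivalence relation whose incidence matrix `F` is in Frobenius normal form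
with primitive nonzero diagonal blocks, the map `μ ↦ p^{(1)} = (μ(X_w^{(1)})/h_w^{(1)})_w`
is a bijection between tail-invariant probability measures on `X_B` and the set
`D = {x ∈ core(A) : Σ_w h_w^{(1)} x_w = 1}` (where `A = F^T`); ergodic measures correspond
precisely to the (normalized) extreme vectors of the cone `core(A)`, and there are only
finitely many of these. -/
theorem stationary_invariant_probability_measures
    (B : BratteliDiagram)
    (hCantor : ∀ x : B.PathSpace, ¬IsOpen ({x} : Set B.PathSpace))
    (haper : B.TailAperiodic)
    (N : ℕ) (hN : 0 < N)
    (ident : ∀ n : ℕ, B.V (n + 1) ≃ Fin N)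
    (F : Matrix (Fin N) (Fin N) ℝ)
    (hstat : ∀ (n : ℕ) (v : B.V (n + 2)) (w : B.V (n + 1)),
      F (ident (n + 1) v) (ident n w) = (B.edgeCount (n + 1) v w : ℝ))
    (m : ℕ) (c : Fin N → Fin m)
    (htri : ∀ i j : Fin N, c i < c j → F i j = 0)
    (hprim : ∀ α : Fin m, (∃ i j : Fin N, c i = α ∧ c j = α ∧ F i j ≠ 0) →
      IsPrimitiveMat (blockOf F c α)) :
    Set.BijOn
      (fun μ : MeasureTheory.Measure B.PathSpace => fun i : Fin N =>
        (μ { x : B.PathSpace | B.endVtx 1 x = (ident 0).symm i }).toReal /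
          (B.height 1 ((ident 0).symm i) : ℝ))
      { μ : MeasureTheory.Measure B.PathSpace |
          MeasureTheory.IsProbabilityMeasure μ ∧ B.TailInvariant μ }
      { x : Fin N → ℝ | x ∈ coreCone F.transpose ∧
          ∑ w : B.V 1, (B.height 1 w : ℝ) * x (ident 0 w) = 1 } ∧
    (∀ μ : MeasureTheory.Measure B.PathSpace,
      MeasureTheory.IsProbabilityMeasure μ → B.TailInvariant μ →
      (B.TailErgodic μ ↔
        IsExtremeRayVec (coreCone F.transpose)
          (fun i : Fin N =>
            (μ { x : B.PathSpace | B.endVtx 1 x = (ident 0).symm i }).toReal /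
              (B.height 1 ((ident 0).symm i) : ℝ)))) ∧
    { x : Fin N → ℝ | x ∈ coreCone F.transpose ∧
        (∑ w : B.V 1, (B.height 1 w : ℝ) * x (ident 0 w) = 1) ∧
        IsExtremeRayVec (coreCone F.transpose) x }.Finite := by
  have hF : BratteliDiagram.IsStationary ident F := hstat
  refine ⟨⟨?_, ?_, ?_⟩, ?_, ?_⟩
  · rintro μ ⟨hprob, hμ⟩
    refine ⟨hF.levelOneVec_mem_coreCone hμ, ?_⟩
    exact (hμ.sum_height_mul_levelOneVec (ident 0)).trans (by simp)
  · rintro μ ⟨hprob, hμ⟩ ν ⟨hprob', hν⟩ h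
    exact hF.eq_of_levelOneVec_eq hμ hν h
  · rintro x ⟨hx, hsum⟩
    obtain ⟨μ, _, hμ, rfl⟩ := hF.exists_levelOneVec_eq hx
    rw [hμ.sum_height_mul_levelOneVec, ENNReal.toReal_eq_one_iff] at hsum
    exact ⟨μ, ⟨⟨hsum⟩, hμ⟩, rfl⟩
  · intro μ _ hμ
    exact ⟨hF.isExtremeRayVec_of_tailErgodic (IsProbabilityMeasure.ne_zero μ) hμ,
      hF.tailErgodic_of_isExtremeRayVec hμ⟩
  · let φ : (Fin N → ℝ) →ₗ[ℝ] ℝ :=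
      ∑ w, (B.height 1 w : ℝ) • LinearMap.proj (ident 0 w)
    refine (finite_normalized_extreme hF.transpose_nonneg hF.one_le_sum_transpose φ).subset ?_
    rintro x ⟨_, hsum, hext⟩
    refine ⟨?_, hext⟩
    simpa [φ] using hsum
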